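/- Let ω ∈ 𝒲 with associated function τ, let δ ∈ (0, m_τ), let {z_j} be a (δ,τ)-lattice of 𝔻, let {e_j} be an orthonormal sequence in A²_ω, and let n ≥ 2 be an integer. Let ρ₀ ∈ (0,1) be the number from the test-function lemma and restrict to the lattice points with |z_j| ≥ ρ₀, with associated test functions F_{z_j,n}. Then there is a constant C, independent of the choice of finite index set J, such that for every finite subcollection J the operator A(f) = ∑_{j∈J} ⟨f, e_j⟩ κ_j, where κ_j = F_{z_j,n}/‖F_{z_j,n}‖_{A²_ω}, satisfies ‖A(f)‖²_{A²_ω} ≤ C ‖f‖²_{A²_ω} for all f ∈ A²_ω. -/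

import Mathlib

open MeasureTheory Filter Set
open scoped ENNReal ComplexOrder

noncomputable section

/-- The open unit disc in `ℂ`. -/
def unitDisc : Set ℂ := Metric.ball (0 : ℂ) 1

/-- Normalized area Lebesgue measure `dA = dx dy / π` on `ℂ`. -/
def dA : Measure ℂ := (ENNReal.ofReal Real.pi)⁻¹ • (volume : Measure ℂ)

/-- The weighted measure `ω dA` on the unit disc. -/
def muW (ω : ℂ → ℝ) : Measure ℂ :=
  (dA.restrict unitDisc).withDensity fun z => ENNReal.ofReal (ω z)

/-- The radial extension to `𝔻` of a function of `r ∈ [0,1)`. -/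
def radialize (τ : ℝ → ℝ) : ℂ → ℝ := fun z => τ (‖z‖)

/-- The class `𝓛`, with constants `c₁, c₂`. -/
structure IsClassL (τC : ℂ → ℝ) (c₁ c₂ : ℝ) : Prop where
  c₁_pos : 0 < c₁
  c₂_pos : 0 < c₂
  pos : ∀ z ∈ unitDisc, 0 < τC z
  upper : ∀ z ∈ unitDisc, τC z ≤ c₁ * (1 - ‖z‖)
  lip : ∀ z ∈ unitDisc, ∀ ζ ∈ unitDisc, |τC z - τC ζ| ≤ c₂ * ‖z - ζ‖

/-- `m_τ = min(1, c₁⁻¹, c₂⁻¹)/4`. -/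
def mTau (c₁ c₂ : ℝ) : ℝ := min 1 (min c₁⁻¹ c₂⁻¹) / 4

/-- The Laplacian `Δφ = φ_xx + φ_yy` of a function `φ : ℂ → ℝ`. -/
def laplacian (φ : ℂ → ℝ) (z : ℂ) : ℝ :=
  fderiv ℝ (fun w => fderiv ℝ φ w 1) z 1 +
    fderiv ℝ (fun w => fderiv ℝ φ w Complex.I) z Complex.I

/-- The Wirtinger derivative `∂̄g = (g_x + i g_y)/2` of `g : ℂ → ℂ`. -/
def dbar (g : ℂ → ℂ) (z : ℂ) : ℂ :=
  (fderiv ℝ g z 1 + Complex.I * fderiv ℝ g z Complex.I) / 2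

/-- The class `𝒲` of weights `ω = e^{-2φ}` with associated radial profile `τ`. -/
structure IsClassW (ω φ : ℂ → ℝ) (τ : ℝ → ℝ) : Prop where
  pos : ∀ z ∈ unitDisc, 0 < ω z
  omega_eq : ∀ z ∈ unitDisc, ω z = Real.exp (-(2 * φ z))
  integrable : ∫⁻ z in unitDisc, ENNReal.ofReal (ω z) ∂dA < ⊤
  radial : ∀ z ∈ unitDisc, ∀ ζ ∈ unitDisc, ‖z‖ = ‖ζ‖ → φ z = φ ζ
  smooth : ContDiffOn ℝ 2 φ unitDisc
  lap_pos : ∀ z ∈ unitDisc, 0 < laplacian φ z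
  tau_pos : ∀ r ∈ Set.Ico (0 : ℝ) 1, 0 < τ r
  tau_anti : AntitoneOn τ (Set.Ico 0 1)
  tau_lim : Tendsto τ (nhdsWithin 1 (Set.Iio 1)) (nhds 0)
  tau_diff : ∀ r ∈ Set.Ico (0 : ℝ) 1, DifferentiableAt ℝ τ r
  tau_deriv_lim : Tendsto (deriv τ) (nhdsWithin 1 (Set.Iio 1)) (nhds 0)
  comp : ∃ C : ℝ, 1 ≤ C ∧ ∀ z ∈ unitDisc,
    τ (‖z‖) / C ≤ (laplacian φ z) ^ (-(1 / 2 : ℝ)) ∧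
      (laplacian φ z) ^ (-(1 / 2 : ℝ)) ≤ C * τ (‖z‖)
  extra : (∃ C > (0 : ℝ), ∃ r₀ ∈ Set.Ico (0 : ℝ) 1,
      MonotoneOn (fun r => τ r * (1 - r) ^ C) (Set.Ico r₀ 1)) ∨
    Tendsto (fun r => deriv τ r * Real.log (1 / τ r)) (nhdsWithin 1 (Set.Iio 1)) (nhds 0)

/-- A `(δ,τ)`-lattice of the unit disc. -/
structure IsLattice (τC : ℂ → ℝ) (δ : ℝ) (z : ℕ → ℂ) : Prop where
  mem : ∀ j, z j ∈ unitDisc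
  sep : ∀ j k, j ≠ k → z j ∉ Metric.ball (z k) (δ * τC (z k))
  covers : ∀ w ∈ unitDisc, ∃ j, w ∈ Metric.ball (z j) (δ * τC (z j))
  mult : ∃ N : ℕ, ∀ w ∈ unitDisc,
    ({j : ℕ | w ∈ Metric.ball (z j) (3 * (δ * τC (z j)))}).ncard ≤ N

/-- The distance `d_τ(z,ζ) = |z-ζ| / min(τ(z),τ(ζ))`. -/
def dTau (τC : ℂ → ℝ) (z ζ : ℂ) : ℝ := ‖z - ζ‖ / min (τC z) (τC ζ)

/-- `(1/|D(δτ(z))|) ∫_{D(δτ(z))} |u|² dA`, valued in `ℝ≥0∞`. -/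
def localMeanE (τC : ℂ → ℝ) (δ : ℝ) (u : ℂ → ℂ) (z : ℂ) : ℝ≥0∞ :=
  (ENNReal.ofReal ((δ * τC z) ^ 2))⁻¹ *
    ∫⁻ w in Metric.ball z (δ * τC z), ENNReal.ofReal (‖u w‖ ^ 2) ∂dA

/-- `F_δ(z)² = inf over h analytic in D(δτ(z)) of the mean square of g - h`. -/
def FdeltaSqE (τC : ℂ → ℝ) (δ : ℝ) (g : ℂ → ℂ) (z : ℂ) : ℝ≥0∞ :=
  ⨅ (h : ℂ → ℂ) (_ : DifferentiableOn ℂ h (Metric.ball z (δ * τC z))),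
    localMeanE τC δ (fun w => g w - h w) z

/-- The submodule of `L²_ω` of elements with a representative analytic on `𝔻`. -/
def bergmanSubmodule (ω : ℂ → ℝ) : Submodule ℂ (Lp ℂ 2 (muW ω)) where
  carrier := {f | ∃ F : ℂ → ℂ, DifferentiableOn ℂ F unitDisc ∧ (f : ℂ → ℂ) =ᵐ[muW ω] F}
  zero_mem' := ⟨0, differentiableOn_const 0, Lp.coeFn_zero ℂ 2 (muW ω)⟩
  add_mem' := by
    rintro a b ⟨F, hF, ha⟩ ⟨G, hG, hb⟩
    refine ⟨F + G, hF.add hG, ?_⟩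
    filter_upwards [Lp.coeFn_add a b, ha, hb] with w h1 h2 h3
    rw [h1]; simp only [Pi.add_apply, h2, h3]
  smul_mem' := by
    rintro c a ⟨F, hF, ha⟩
    refine ⟨c • F, hF.const_smul c, ?_⟩
    filter_upwards [Lp.coeFn_smul c a, ha] with w h1 h2
    rw [h1]; simp only [Pi.smul_apply, h2]

/-- The Bergman space `A²_ω`, a closed subspace of `L²_ω`. -/
def bergmanH (ω : ℂ → ℝ) : Submodule ℂ (Lp ℂ 2 (muW ω)) :=
  (bergmanSubmodule ω).topologicalClosure

instance (ω : ℂ → ℝ) : CompleteSpace (bergmanH ω) :=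
  (Submodule.isClosed_topologicalClosure _).isComplete.completeSpace_coe

/-- The orthogonal (Bergman) projection of `L²_ω` onto `A²_ω`, valued in `A²_ω`. -/
def bergmanProjA (ω : ℂ → ℝ) : Lp ℂ 2 (muW ω) →L[ℂ] bergmanH ω :=
  Submodule.orthogonalProjectionOnto (bergmanH ω)

/-- The Bergman projection `P`, viewed as an operator of `L²_ω`. -/
def bergmanProj (ω : ℂ → ℝ) : Lp ℂ 2 (muW ω) →L[ℂ] Lp ℂ 2 (muW ω) :=
  (bergmanH ω).subtypeL.comp (bergmanProjA ω)

/-- `T` is a bounded extension of the Hankel operator `H_g : f ↦ g f - P(g f)`,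
defined on the bounded analytic functions `f ∈ H^∞`. -/
def IsHankelExtension (ω : ℂ → ℝ) (g : ℂ → ℂ)
    (T : bergmanH ω →L[ℂ] Lp ℂ 2 (muW ω)) : Prop :=
  ∀ (f : bergmanH ω) (F : ℂ → ℂ) (M : ℝ),
    DifferentiableOn ℂ F unitDisc →
    (∀ z ∈ unitDisc, ‖F z‖ ≤ M) →
    ((f : Lp ℂ 2 (muW ω)) : ℂ → ℂ) =ᵐ[muW ω] F →
    ∀ gF : Lp ℂ 2 (muW ω), ((gF : ℂ → ℂ) =ᵐ[muW ω] fun z => g z * F z) →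
    T f = gF - bergmanProj ω gF

/-- The `ν`-th singular number `s_ν(T) = inf{‖T - K‖ : rank K ≤ ν}`, `ν = 0, 1, 2, …`. -/
def singularNumber {E F : Type*} [NormedAddCommGroup E] [NormedSpace ℂ E]
    [NormedAddCommGroup F] [NormedSpace ℂ F] (T : E →L[ℂ] F) (ν : ℕ) : ℝ :=
  sInf {c : ℝ | ∃ K : E →L[ℂ] F,
    Module.rank ℂ (LinearMap.range (K : E →ₗ[ℂ] F)) ≤ (ν : Cardinal) ∧ c = ‖T - K‖}

/-- `‖T‖_{S^p}^p = ∑_ν s_ν(T)^p`. -/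
def schattenSum (p : ℝ) {E F : Type*} [NormedAddCommGroup E] [NormedSpace ℂ E]
    [NormedAddCommGroup F] [NormedSpace ℂ F] (T : E →L[ℂ] F) : ℝ :=
  ∑' ν : ℕ, singularNumber T ν ^ p

/-- Membership in the Schatten class `S^p`: `∑_ν s_ν(T)^p < ∞`. -/
def MemSchatten (p : ℝ) {E F : Type*} [NormedAddCommGroup E] [NormedSpace ℂ E]
    [NormedAddCommGroup F] [NormedSpace ℂ F] (T : E →L[ℂ] F) : Prop :=
  Summable fun ν : ℕ => singularNumber T ν ^ p

/-- A bounded operator has finite rank. -/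
def FiniteRank {E F : Type*} [NormedAddCommGroup E] [NormedSpace ℂ E]
    [NormedAddCommGroup F] [NormedSpace ℂ F] (T : E →L[ℂ] F) : Prop :=
  Module.rank ℂ (LinearMap.range (T : E →ₗ[ℂ] F)) < Cardinal.aleph0

/-- The decay estimate `|F(z)| ω(z)^{1/2} ≲ min(1, min(τ(α),τ(z))/|z-α|)^{3n}` on `𝔻`. -/
def TestDecay (τC ω : ℂ → ℝ) (C₀ : ℝ) (n : ℕ) (α : ℂ) (F : ℂ → ℂ) : Prop :=
  (∀ z ∈ unitDisc, ‖F z‖ * Real.sqrt (ω z) ≤ C₀) ∧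
    ∀ z ∈ unitDisc, z ≠ α → ‖F z‖ * Real.sqrt (ω z) ≤
      C₀ * (min (τC α) (τC z) / ‖z - α‖) ^ (3 * n)

/-- Multiplication of an `L²_ω` element by the indicator of a measurable set `D`. -/
def indLp (ω : ℂ → ℝ) (D : Set ℂ) (hD : MeasurableSet D) (f : Lp ℂ 2 (muW ω)) :
    Lp ℂ 2 (muW ω) :=
  MemLp.toLp (D.indicator f) ((Lp.memLp f).indicator hD)

/-- The subspace of `L²_ω` of elements vanishing a.e. off `D` with a representative
analytic on `D`;  its closure realizes `A²_ω(D)` inside `L²_ω`. -/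
def localBergmanSub (ω : ℂ → ℝ) (D : Set ℂ) : Submodule ℂ (Lp ℂ 2 (muW ω)) where
  carrier := {f | ((f : ℂ → ℂ) =ᵐ[(muW ω).restrict Dᶜ] 0) ∧
    ∃ h : ℂ → ℂ, DifferentiableOn ℂ h D ∧ (f : ℂ → ℂ) =ᵐ[(muW ω).restrict D] h}
  zero_mem' := by
    refine ⟨ae_restrict_of_ae (Lp.coeFn_zero ℂ 2 (muW ω)), 0, differentiableOn_const 0,
      ae_restrict_of_ae (Lp.coeFn_zero ℂ 2 (muW ω))⟩
  add_mem' := by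
    rintro a b ⟨ha0, F, hF, ha⟩ ⟨hb0, G, hG, hb⟩
    refine ⟨?_, F + G, hF.add hG, ?_⟩
    · filter_upwards [ae_restrict_of_ae (Lp.coeFn_add a b), ha0, hb0] with w h1 h2 h3
      rw [h1]; simp only [Pi.add_apply, h2, h3, Pi.zero_apply, add_zero]
    · filter_upwards [ae_restrict_of_ae (Lp.coeFn_add a b), ha, hb] with w h1 h2 h3
      rw [h1]; simp only [Pi.add_apply, h2, h3]
  smul_mem' := by
    rintro c a ⟨ha0, F, hF, ha⟩
    refine ⟨?_, c • F, hF.const_smul c, ?_⟩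
    · filter_upwards [ae_restrict_of_ae (Lp.coeFn_smul c a), ha0] with w h1 h2
      rw [h1]; simp only [Pi.smul_apply, h2, Pi.zero_apply, smul_zero]
    · filter_upwards [ae_restrict_of_ae (Lp.coeFn_smul c a), ha] with w h1 h2
      rw [h1]; simp only [Pi.smul_apply, h2]

instance (ω : ℂ → ℝ) (D : Set ℂ) :
    CompleteSpace ((localBergmanSub ω D).topologicalClosure) :=
  (Submodule.isClosed_topologicalClosure _).isComplete.completeSpace_coe

/-- The local projection `P_{α,δ}` (for `D = D(δτ(α))`), extended by zero off `D`,
viewed as an operator of `L²_ω`. -/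
def localProj (ω : ℂ → ℝ) (D : Set ℂ) : Lp ℂ 2 (muW ω) →L[ℂ] Lp ℂ 2 (muW ω) :=
  ((localBergmanSub ω D).topologicalClosure).subtypeL.comp
    (Submodule.orthogonalProjectionOnto ((localBergmanSub ω D).topologicalClosure))

/-- The decaying bump `(1+|x|/t)^{-3}`. -/
def bumpP (t : ℝ) (x : ℂ) : ℝ := ((1 + ‖x‖ / t) ^ 3)⁻¹

theorem bumpP_nonneg {t : ℝ} (ht : 0 < t) (x : ℂ) : 0 ≤ bumpP t x := by
  unfold bumpP; positivity

theorem bumpP_one_integrable : Integrable (bumpP 1) (volume : Measure ℂ) := by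
  have h := integrable_one_add_norm (E := ℂ) (μ := volume) (r := 3)
    (by rw [Complex.finrank_real_complex]; norm_num)
  refine h.congr (ae_of_all _ fun x => ?_)
  simp only [bumpP, div_one]
  rw [Real.rpow_neg (by positivity)]
  norm_cast

theorem bumpP_scale {t : ℝ} (x : ℂ) : bumpP t x = bumpP 1 (t⁻¹ • x) ∨ t ≤ 0 := by
  by_cases ht : 0 < t
  · left
    simp only [bumpP, norm_smul, norm_inv, Real.norm_eq_abs, abs_of_pos ht, div_one]
    rw [inv_mul_eq_div]
  · right; linarith

theorem bumpP_integrable {t : ℝ} (ht : 0 < t) (a : ℂ) :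
    Integrable (fun w => bumpP t (w - a)) (volume : Measure ℂ) := by
  have h : bumpP t = fun x => bumpP 1 (t⁻¹ • x) :=
    funext fun x => (bumpP_scale x).resolve_right (not_le.2 ht)
  have h2 : Integrable (bumpP t) (volume : Measure ℂ) := by
    rw [h]
    exact bumpP_one_integrable.comp_smul (inv_ne_zero ht.ne')
  exact h2.comp_sub_right a

theorem bumpP_integral {t : ℝ} (ht : 0 < t) (a : ℂ) :
    ∫ w, bumpP t (w - a) = t ^ 2 * ∫ w, bumpP 1 w := by
  have h : bumpP t = fun x => bumpP 1 (t⁻¹ • x) :=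
    funext fun x => (bumpP_scale x).resolve_right (not_le.2 ht)
  rw [integral_sub_right_eq_self (bumpP t) a, h, Measure.integral_comp_inv_smul,
    Complex.finrank_real_complex, abs_of_pos (by positivity), smul_eq_mul]

theorem decay_majorant {τj τw c d k C₀ : ℝ} {n : ℕ} (hn : 2 ≤ n) (hj : 0 < τj) (hw : 0 < τw)
    (hc : 0 < c) (hd : 0 ≤ d) (hC : 0 ≤ C₀) (hlip : τw ≤ τj + c * d)
    (h1 : k ≤ C₀) (h2 : d ≠ 0 → k ≤ C₀ * (min τj τw / d) ^ (3 * n)) :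
    ∃ u : ℝ, 0 ≤ u ∧ k ≤ C₀ * u ∧ u ≤ 8 * ((1 + d / τj) ^ 3)⁻¹ ∧
      u ≤ 8 * (1 + c) ^ 2 * (τj / τw) ^ 2 * ((1 + d / τw) ^ 3)⁻¹ := by
  obtain ⟨q, q0, q1, qj, qw, hk⟩ : ∃ q : ℝ, 0 ≤ q ∧ q ≤ 1 ∧ q * d ≤ τj ∧ q * d ≤ τw ∧
      k ≤ C₀ * q ^ (3 * n) := by
    have hm : 0 < min τj τw := lt_min hj hw
    by_cases hdm : d ≤ min τj τw
    · refine ⟨1, by norm_num, le_rfl, ?_, ?_, by simpa using h1⟩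
      · simpa using hdm.trans (min_le_left _ _)
      · simpa using hdm.trans (min_le_right _ _)
    · push Not at hdm
      have hd0 : 0 < d := hm.trans hdm
      refine ⟨min τj τw / d, by positivity, (div_le_one hd0).2 hdm.le, ?_, ?_, h2 hd0.ne'⟩
      · rw [div_mul_cancel₀ _ hd0.ne']; exact min_le_left _ _
      · rw [div_mul_cancel₀ _ hd0.ne']; exact min_le_right _ _
  have key : ∀ t : ℝ, 0 < t → q * d ≤ t → q ^ 3 ≤ 8 * ((1 + d / t) ^ 3)⁻¹ := by
    intro t ht hq
    have h0 : 0 < 1 + d / t := by positivity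
    have : q * (1 + d / t) ≤ 2 := by
      have : q * d / t ≤ 1 := (div_le_one ht).2 hq
      rw [mul_add, mul_one, ← mul_div_assoc]; linarith
    have h3 : (q * (1 + d / t)) ^ 3 ≤ 2 ^ 3 := pow_le_pow_left₀ (by positivity) this 3
    rw [← div_eq_mul_inv, le_div_iff₀ (by positivity), ← mul_pow]
    linarith
  refine ⟨q ^ 5, by positivity, hk.trans ?_, ?_, ?_⟩
  · exact mul_le_mul_of_nonneg_left (pow_le_pow_of_le_one q0 q1 (by omega)) hC
  · exact (pow_le_pow_of_le_one q0 q1 (by norm_num)).trans (key τj hj qj)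
  · have hq : q ≤ (1 + c) * (τj / τw) := by
      rw [← mul_div_assoc, le_div_iff₀ hw]
      nlinarith [mul_le_mul_of_nonneg_left hlip q0, mul_le_mul_of_nonneg_left qj hc.le,
        mul_le_mul_of_nonneg_right q1 hj.le]
    have hq2 : q ^ 2 ≤ ((1 + c) * (τj / τw)) ^ 2 := pow_le_pow_left₀ q0 hq 2
    calc q ^ 5 = q ^ 2 * q ^ 3 := by ring
      _ ≤ ((1 + c) * (τj / τw)) ^ 2 * (8 * ((1 + d / τw) ^ 3)⁻¹) :=
        mul_le_mul hq2 (key τw hw qw) (by positivity) (by positivity)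
      _ = _ := by ring

/-- The lattice sum estimate. -/
theorem lattice_sum (τC : ℂ → ℝ) (c₂ δ : ℝ) (z : ℕ → ℂ) (hδ : 0 < δ) (hδ1 : δ ≤ 1)
    (hδc : δ * c₂ ≤ 1) (pos : ∀ j, 0 < τC (z j))
    (sep : ∀ j k, j ≠ k → z j ∉ Metric.ball (z k) (δ * τC (z k)))
    (w : ℂ) (hw : 0 < τC w) (lip : ∀ j, τC (z j) ≤ τC w + c₂ * ‖w - z j‖) (J : Finset ℕ) :
    ∑ j ∈ J, (τC (z j) / τC w) ^ 2 * bumpP (τC w) (w - z j) ≤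
      8 / (Real.pi * (δ / 2) ^ 2) * ∫ x, bumpP 1 x := by
  have hpi := Real.pi_pos
  set B : ℕ → Set ℂ := fun j => Metric.ball (z j) (δ / 2 * τC (z j)) with hB
  have hdisj : Pairwise (fun i j => Disjoint (B i) (B j)) := by
    intro i j hij
    have h1 := sep i j hij
    have h2 := sep j i hij.symm
    rw [Metric.mem_ball, not_lt] at h1 h2
    rw [dist_comm] at h2
    apply Metric.ball_disjoint_ball
    linarith
  have hbint : Integrable (fun x => bumpP (τC w) (x - w)) volume := bumpP_integrable hw w
  have hterm : ∀ j, (τC (z j) / τC w) ^ 2 * bumpP (τC w) (w - z j) ≤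
      8 / (Real.pi * (δ / 2) ^ 2) * ((τC w) ^ 2)⁻¹ * ∫ x in B j, bumpP (τC w) (x - w) := by
    intro j
    have hpj := pos j
    have hvol : (volume (B j)).toReal = Real.pi * (δ / 2 * τC (z j)) ^ 2 := by
      rw [hB, Complex.volume_ball, ENNReal.toReal_mul, ENNReal.toReal_pow,
        ENNReal.toReal_ofReal (by positivity), mul_comm]
      rfl
    have hlow : ∀ x ∈ B j, bumpP (τC w) (w - z j) / 8 ≤ bumpP (τC w) (x - w) := by
      intro x hx
      have hx' : ‖x - z j‖ < δ / 2 * τC (z j) := by simpa [hB, dist_eq_norm] using hx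
      have htri : ‖x - w‖ ≤ ‖x - z j‖ + ‖w - z j‖ := by
        have := norm_sub_le (x - z j) (w - z j)
        simpa using this
      have hl := lip j
      have hD : 0 ≤ ‖w - z j‖ := norm_nonneg _
      have hle : ‖x - w‖ ≤ τC w + 2 * ‖w - z j‖ := by
        have := mul_le_mul_of_nonneg_left hl (by positivity : 0 ≤ δ / 2)
        nlinarith [mul_le_mul_of_nonneg_right hδc hD, mul_le_mul_of_nonneg_right hδ1 hw.le]
      have h2 : 1 + ‖x - w‖ / τC w ≤ 2 * (1 + ‖w - z j‖ / τC w) := by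
        have : ‖x - w‖ / τC w ≤ 1 + 2 * (‖w - z j‖ / τC w) := by
          rw [div_le_iff₀ hw]
          have : (1 + 2 * (‖w - z j‖ / τC w)) * τC w = τC w + 2 * ‖w - z j‖ := by
            field_simp
          linarith
        linarith
      unfold bumpP
      rw [div_eq_mul_inv, ← mul_inv]
      apply inv_anti₀ (by positivity)
      calc (1 + ‖x - w‖ / τC w) ^ 3 ≤ (2 * (1 + ‖w - z j‖ / τC w)) ^ 3 :=
            pow_le_pow_left₀ (by positivity) h2 3
        _ = _ := by ring
    have hfin : volume (B j) ≠ ⊤ := measure_ball_lt_top.ne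
    have hI : (volume (B j)).toReal * (bumpP (τC w) (w - z j) / 8) ≤
        ∫ x in B j, bumpP (τC w) (x - w) := by
      have := setIntegral_mono_on (μ := volume) (s := B j)
        (f := fun _ => bumpP (τC w) (w - z j) / 8) (g := fun x => bumpP (τC w) (x - w))
        (integrableOn_const hfin) hbint.integrableOn Metric.isOpen_ball.measurableSet hlow
      simpa [setIntegral_const, Measure.real] using this
    rw [hvol] at hI
    have := mul_le_mul_of_nonneg_left hI
      (by positivity : 0 ≤ 8 / (Real.pi * (δ / 2) ^ 2) * ((τC w) ^ 2)⁻¹)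
    refine le_trans (le_of_eq ?_) this
    field_simp
  calc _ ≤ ∑ j ∈ J, 8 / (Real.pi * (δ / 2) ^ 2) * ((τC w) ^ 2)⁻¹ *
        ∫ x in B j, bumpP (τC w) (x - w) := Finset.sum_le_sum fun j _ => hterm j
    _ = 8 / (Real.pi * (δ / 2) ^ 2) * ((τC w) ^ 2)⁻¹ *
        ∫ x in ⋃ j ∈ J, B j, bumpP (τC w) (x - w) := by
      rw [← Finset.mul_sum, integral_biUnion_finset J
        (fun j _ => Metric.isOpen_ball.measurableSet) (fun i _ j _ hij => hdisj hij)
        (fun j _ => hbint.integrableOn)]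
    _ ≤ 8 / (Real.pi * (δ / 2) ^ 2) * ((τC w) ^ 2)⁻¹ * ∫ x, bumpP (τC w) (x - w) := by
      apply mul_le_mul_of_nonneg_left _ (by positivity)
      exact setIntegral_le_integral hbint (ae_of_all _ fun x => bumpP_nonneg hw _)
    _ = _ := by
      rw [bumpP_integral hw]; field_simp

theorem norm_sq_bound (ω φ : ℂ → ℝ) (hpos : ∀ w ∈ unitDisc, 0 < ω w)
    (hω : ∀ w ∈ unitDisc, ω w = Real.exp (-(2 * φ w))) (hφ : ContinuousOn φ unitDisc)
    (g : Lp ℂ 2 (muW ω)) (G : ℂ → ℂ) (hG : (g : ℂ → ℂ) =ᵐ[muW ω] G) (H : ℂ → ℝ)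
    (hH : Integrable H volume) (hH0 : ∀ w, 0 ≤ H w)
    (hle : ∀ w ∈ unitDisc, ‖G w‖ ^ 2 * ω w ≤ H w) :
    ‖g‖ ^ 2 ≤ Real.pi⁻¹ * ∫ w, H w := by
  have hms : MeasurableSet unitDisc := Metric.isOpen_ball.measurableSet
  have hHd : Integrable H dA := by
    unfold dA
    exact hH.smul_measure (by simp [Real.pi_pos])
  have hωc : ContinuousOn ω unitDisc := by
    have : ContinuousOn (fun w => Real.exp (-(2 * φ w))) unitDisc :=
      Real.continuous_exp.comp_continuousOn ((continuousOn_const.mul hφ).neg)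
    exact this.congr hω
  have hωm : AEMeasurable (fun w => ENNReal.ofReal (ω w)) (dA.restrict unitDisc) :=
    (hωc.aemeasurable hms).ennreal_ofReal
  have h1 : ‖g‖ ^ 2 = ∫ w, ‖G w‖ ^ 2 ∂(muW ω) := by
    have h := L2.inner_def (𝕜 := ℂ) g g
    rw [inner_self_eq_norm_sq_to_K] at h
    have h2 : (∫ a, inner ℂ ((g : ℂ → ℂ) a) ((g : ℂ → ℂ) a) ∂(muW ω)) =
        ((∫ w, ‖G w‖ ^ 2 ∂(muW ω) : ℝ) : ℂ) := by
      rw [← integral_complex_ofReal]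
      refine integral_congr_ae ?_
      filter_upwards [hG] with w hw
      rw [hw, inner_self_eq_norm_sq_to_K]
      push_cast; rfl
    rw [h2] at h
    have h5 : ((‖g‖ ^ 2 : ℝ) : ℂ) = ((∫ w, ‖G w‖ ^ 2 ∂(muW ω) : ℝ) : ℂ) := by
      rw [← h]; push_cast; rfl
    exact Complex.ofReal_injective h5
  rw [h1]
  unfold muW
  rw [integral_withDensity_eq_integral_toReal_smul₀ hωm (ae_of_all _ fun _ => by simp)]
  calc _ ≤ ∫ w in unitDisc, H w ∂dA := by
        refine integral_mono_of_nonneg (ae_of_all _ fun w => ?_) hHd.integrableOn ?_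
        · simp only [Pi.zero_apply, smul_eq_mul]; positivity
        · refine (ae_restrict_iff' hms).2 (ae_of_all _ fun w hw => ?_)
          simp only [smul_eq_mul]
          rw [ENNReal.toReal_ofReal (hpos w hw).le, mul_comm]
          exact hle w hw
    _ ≤ ∫ w, H w ∂dA := setIntegral_le_integral hHd (ae_of_all _ hH0)
    _ = _ := by
      unfold dA
      rw [integral_smul_measure, ENNReal.toReal_inv, ENNReal.toReal_ofReal Real.pi_pos.le,
        smul_eq_mul]

theorem stmt5 (ω φ : ℂ → ℝ) (τ : ℝ → ℝ) (c₁ c₂ : ℝ)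
    (hW : IsClassW ω φ τ) (hL : IsClassL (radialize τ) c₁ c₂)
    (δ : ℝ) (hδ : δ ∈ Set.Ioo 0 (mTau c₁ c₂))
    (z : ℕ → ℂ) (hz : IsLattice (radialize τ) δ z)
    (e : ℕ → bergmanH ω) (he : Orthonormal ℂ e)
    (n : ℕ) (hn : 2 ≤ n) (ρ₀ : ℝ) (hρ : ρ₀ ∈ Set.Ioo (0 : ℝ) 1)
    (F : ℕ → bergmanH ω) (Frep : ℕ → ℂ → ℂ) (C₀ : ℝ) (hC₀ : 1 ≤ C₀)
    (hFrep : ∀ j, (((F j : Lp ℂ 2 (muW ω)) : ℂ → ℂ)) =ᵐ[muW ω] Frep j)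
    (hFan : ∀ j, DifferentiableOn ℂ (Frep j) unitDisc)
    (hFbd : ∀ j, ∃ M : ℝ, ∀ w ∈ unitDisc, ‖Frep j w‖ ≤ M)
    (hpeak : ∀ j, ρ₀ ≤ ‖z j‖ → ∀ w ∈ unitDisc,
      ‖w - z j‖ < radialize τ (z j) →
        C₀⁻¹ ≤ ‖Frep j w‖ ^ 2 * ω w ∧ ‖Frep j w‖ ^ 2 * ω w ≤ C₀)
    (hdecay : ∀ j, ρ₀ ≤ ‖z j‖ → TestDecay (radialize τ) ω C₀ n (z j) (Frep j))
    (hnorm : ∀ j, ρ₀ ≤ ‖z j‖ →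
      radialize τ (z j) / C₀ ≤ ‖F j‖ ∧ ‖F j‖ ≤ C₀ * radialize τ (z j)) :
    ∃ C : ℝ, ∀ J : Finset ℕ, (∀ j ∈ J, ρ₀ ≤ ‖z j‖) →
      ∀ f : bergmanH ω,
        ‖∑ j ∈ J, (inner ℂ (e j) f : ℂ) • ((‖F j‖)⁻¹ • F j)‖ ^ 2 ≤ C * ‖f‖ ^ 2 := by
  have hδ0 : 0 < δ := hδ.1
  have hc2 := hL.c₂_pos
  have hδm : δ < min 1 (min c₁⁻¹ c₂⁻¹) / 4 := hδ.2
  have hm1 : min 1 (min c₁⁻¹ c₂⁻¹) ≤ 1 := min_le_left _ _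
  have hm2 : min 1 (min c₁⁻¹ c₂⁻¹) ≤ c₂⁻¹ := (min_le_right _ _).trans (min_le_right _ _)
  have hδ1 : δ ≤ 1 := by linarith
  have hδc : δ * c₂ ≤ 1 := by
    have h1 : δ ≤ c₂⁻¹ := by
      have : 0 < c₂⁻¹ := inv_pos.2 hc2
      linarith
    calc δ * c₂ ≤ c₂⁻¹ * c₂ := mul_le_mul_of_nonneg_right h1 hc2.le
      _ = 1 := inv_mul_cancel₀ hc2.ne'
  have hC0 : 0 < C₀ := by linarith
  set T : ℂ → ℝ := radialize τ with hT
  set I : ℝ := ∫ x, bumpP 1 x with hI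
  have hI0 : 0 ≤ I := integral_nonneg fun x => bumpP_nonneg one_pos x
  set S : ℝ := 8 * (1 + c₂) ^ 2 * (8 / (Real.pi * (δ / 2) ^ 2) * I) with hS
  have hS0 : 0 ≤ S := by have := Real.pi_pos; positivity
  have hTj : ∀ j, 0 < T (z j) := fun j => hL.pos _ (hz.mem j)
  refine ⟨Real.pi⁻¹ * (C₀ ^ 4 * S * (8 * I)), fun J hJ f => ?_⟩
  set a : ℕ → ℂ := fun j => inner ℂ (e j) f with ha
  have hbessel : ∑ j ∈ J, ‖a j‖ ^ 2 ≤ ‖f‖ ^ 2 := he.sum_inner_products_le f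
  set H : ℂ → ℝ := fun w => C₀ ^ 4 * S *
    ∑ j ∈ J, ‖a j‖ ^ 2 * (8 * ((T (z j)) ^ 2)⁻¹) * bumpP (T (z j)) (w - z j) with hH
  have hHi : Integrable H volume :=
    (integrable_finsetSum J fun j _ => (bumpP_integrable (hTj j) (z j)).const_mul _).const_mul _
  have hH0 : ∀ w, 0 ≤ H w := fun w => mul_nonneg (by positivity)
    (Finset.sum_nonneg fun j _ => mul_nonneg (by positivity) (bumpP_nonneg (hTj j) _))
  have hHint : ∫ w, H w = C₀ ^ 4 * S * (8 * I) * ∑ j ∈ J, ‖a j‖ ^ 2 := by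
    simp only [hH]
    rw [integral_const_mul, integral_finsetSum J
      (fun j _ => (bumpP_integrable (hTj j) (z j)).const_mul _), mul_assoc (C₀ ^ 4 * S) (8 * I),
      Finset.mul_sum J _ (8 * I)]
    congr 1
    refine Finset.sum_congr rfl fun j _ => ?_
    rw [integral_const_mul, bumpP_integral (hTj j), ← hI]
    have := (hTj j).ne'
    field_simp
  set G : ℂ → ℂ := fun w => ∑ j ∈ J, a j * ((‖F j‖⁻¹ : ℝ) * Frep j w) with hG
  have hGae : (((∑ j ∈ J, a j • ((‖F j‖)⁻¹ • F j) : bergmanH ω) : Lp ℂ 2 (muW ω)) : ℂ → ℂ)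
      =ᵐ[muW ω] G := by
    have hcoe : ((∑ j ∈ J, a j • ((‖F j‖)⁻¹ • F j) : bergmanH ω) : Lp ℂ 2 (muW ω)) =
        ∑ j ∈ J, (a j * ((‖F j‖⁻¹ : ℝ) : ℂ)) • (F j : Lp ℂ 2 (muW ω)) := by
      rw [Submodule.coe_sum]
      refine Finset.sum_congr rfl fun j _ => ?_
      rw [mul_smul]
      rfl
    rw [hcoe]
    have h1 := Lp.coeFn_finsetSum J
      (fun j => (a j * ((‖F j‖⁻¹ : ℝ) : ℂ)) • (F j : Lp ℂ 2 (muW ω)))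
    have h2 : ∀ᵐ w ∂(muW ω), ∀ j : ℕ,
        (((a j * ((‖F j‖⁻¹ : ℝ) : ℂ)) • (F j : Lp ℂ 2 (muW ω)) : Lp ℂ 2 (muW ω)) : ℂ → ℂ) w =
          a j * ((‖F j‖⁻¹ : ℝ) * Frep j w) := by
      rw [ae_all_iff]
      intro j
      filter_upwards [Lp.coeFn_smul (a j * ((‖F j‖⁻¹ : ℝ) : ℂ)) (F j : Lp ℂ 2 (muW ω)),
        hFrep j] with w h3 h4
      rw [h3, Pi.smul_apply, h4, smul_eq_mul, mul_assoc]
    filter_upwards [h1, h2] with w h3 h4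
    rw [h3, hG]
    simp only [Finset.sum_apply, h4]
  have hle : ∀ w ∈ unitDisc, ‖G w‖ ^ 2 * ω w ≤ H w := by
    intro w hw
    have hTw : 0 < T w := hL.pos w hw
    have hωw := hW.pos w hw
    have hlip := fun j => abs_le.1 (hL.lip w hw (z j) (hz.mem j))
    have hmaj : ∀ j, ∃ u : ℝ, j ∈ J → (0 ≤ u ∧ ‖Frep j w‖ * Real.sqrt (ω w) ≤ C₀ * u ∧
        u ≤ 8 * bumpP (T (z j)) (w - z j) ∧
        u ≤ 8 * (1 + c₂) ^ 2 * (T (z j) / T w) ^ 2 * bumpP (T w) (w - z j)) := by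
      intro j
      by_cases hj : j ∈ J
      · obtain ⟨hd1, hd2⟩ := hdecay j (hJ j hj)
        obtain ⟨u, hu⟩ := decay_majorant (k := ‖Frep j w‖ * Real.sqrt (ω w)) hn (hTj j) hTw hc2
          (norm_nonneg (w - z j)) hC0.le (by linarith [(hlip j).2]) (hd1 w hw)
          (fun h => hd2 w hw (fun h' => h (by simp [h'])))
        exact ⟨u, fun _ => hu⟩
      · exact ⟨0, fun h => absurd h hj⟩
    choose u hu using hmaj
    have hsumu : ∑ j ∈ J, u j ≤ S := by
      calc _ ≤ ∑ j ∈ J, 8 * (1 + c₂) ^ 2 * ((T (z j) / T w) ^ 2 * bumpP (T w) (w - z j)) :=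
            Finset.sum_le_sum fun j hj => by rw [← mul_assoc]; exact (hu j hj).2.2.2
        _ ≤ S := by
          rw [← Finset.mul_sum]
          exact mul_le_mul_of_nonneg_left
            (lattice_sum T c₂ δ z hδ0 hδ1 hδc hTj hz.sep w hTw
              (fun j => by linarith [(hlip j).1]) J) (by positivity)
    have hGn : ‖G w‖ * Real.sqrt (ω w) ≤ C₀ ^ 2 * ∑ j ∈ J, u j * (‖a j‖ / T (z j)) := by
      calc ‖G w‖ * Real.sqrt (ω w)
          ≤ (∑ j ∈ J, ‖a j * ((‖F j‖⁻¹ : ℝ) * Frep j w)‖) * Real.sqrt (ω w) :=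
            mul_le_mul_of_nonneg_right (norm_sum_le _ _) (Real.sqrt_nonneg _)
        _ ≤ C₀ ^ 2 * ∑ j ∈ J, u j * (‖a j‖ / T (z j)) := by
          rw [Finset.sum_mul, Finset.mul_sum]
          refine Finset.sum_le_sum fun j hj => ?_
          obtain ⟨u0, hk, -, -⟩ := hu j hj
          have hFn := (hnorm j (hJ j hj)).1
          have hpj := hTj j
          have hinv : ‖F j‖⁻¹ ≤ C₀ / T (z j) := by
            rw [← inv_div]
            exact inv_anti₀ (by positivity) hFn
          rw [norm_mul, norm_mul, Complex.norm_real, norm_inv, norm_norm]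
          calc ‖a j‖ * (‖F j‖⁻¹ * ‖Frep j w‖) * Real.sqrt (ω w)
              = ‖a j‖ * (‖F j‖⁻¹ * (‖Frep j w‖ * Real.sqrt (ω w))) := by ring
            _ ≤ ‖a j‖ * ((C₀ / T (z j)) * (C₀ * u j)) := by gcongr
            _ = _ := by ring
    have hCS : (∑ j ∈ J, u j * (‖a j‖ / T (z j))) ^ 2 ≤
        (∑ j ∈ J, u j) * ∑ j ∈ J, u j * (‖a j‖ / T (z j)) ^ 2 := by
      refine Finset.sum_sq_le_sum_mul_sum_of_sq_le_mul J (fun j hj => (hu j hj).1)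
        (fun j hj => mul_nonneg (hu j hj).1 (sq_nonneg _)) (fun j _ => le_of_eq (by ring))
    have hX0 : 0 ≤ ∑ j ∈ J, u j * (‖a j‖ / T (z j)) ^ 2 :=
      Finset.sum_nonneg fun j hj => mul_nonneg (hu j hj).1 (sq_nonneg _)
    calc ‖G w‖ ^ 2 * ω w = (‖G w‖ * Real.sqrt (ω w)) ^ 2 := by
          rw [mul_pow, Real.sq_sqrt hωw.le]
      _ ≤ (C₀ ^ 2 * ∑ j ∈ J, u j * (‖a j‖ / T (z j))) ^ 2 :=
        pow_le_pow_left₀ (by positivity) hGn 2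
      _ = C₀ ^ 4 * (∑ j ∈ J, u j * (‖a j‖ / T (z j))) ^ 2 := by ring
      _ ≤ C₀ ^ 4 * (S * ∑ j ∈ J, u j * (‖a j‖ / T (z j)) ^ 2) := by
        apply mul_le_mul_of_nonneg_left _ (by positivity)
        exact hCS.trans (mul_le_mul_of_nonneg_right hsumu hX0)
      _ ≤ H w := by
        rw [← mul_assoc]
        apply mul_le_mul_of_nonneg_left _ (by positivity)
        refine Finset.sum_le_sum fun j hj => ?_
        calc u j * (‖a j‖ / T (z j)) ^ 2
            ≤ (8 * bumpP (T (z j)) (w - z j)) * (‖a j‖ / T (z j)) ^ 2 :=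
              mul_le_mul_of_nonneg_right (hu j hj).2.2.1 (sq_nonneg _)
          _ = _ := by rw [div_pow, div_eq_mul_inv]; ring
  have hfinal := norm_sq_bound ω φ hW.pos hW.omega_eq hW.smooth.continuousOn _ G hGae H hHi hH0 hle
  rw [hHint] at hfinal
  calc _ ≤ Real.pi⁻¹ * (C₀ ^ 4 * S * (8 * I) * ∑ j ∈ J, ‖a j‖ ^ 2) := hfinal
    _ = Real.pi⁻¹ * (C₀ ^ 4 * S * (8 * I)) * ∑ j ∈ J, ‖a j‖ ^ 2 := by ring
    _ ≤ _ := mul_le_mul_of_nonneg_left hbessel (by have := Real.pi_pos; positivity)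

end
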